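/- Let n, ℓ, r be positive integers, q = 2^r, m = 2^ℓ, with q ≥ m ≥ n ≥ 2. Let X ⊆ Z_q be a set of n elements. Choose a uniformly at random from the odd residues in Z_q and define h : Z_q → {0,1,...,m−1} by h(x) = ⌊ lift_q(a·x) · m / q ⌋. Let M = max over y ∈ {0,...,m−1} of |{x ∈ X : h(x) = y}|. Then there is an absolute constant C such that for every real α with 1 ≤ α ≤ n/4, Pr[M ≥ 4α] ≤ C · n · log(n) / α³. -/

import Mathlib

open Finset

/-- Weighting every point of `S` by the inverse size of its `f`-fibre counts the fibres. -/
lemma sum_inv_card_fiber {ι κ : Type*} [DecidableEq κ] (S : Finset ι) (f : ι → κ) :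
    ∑ x ∈ S, (1 : ℝ) / (#{z ∈ S | f z = f x} : ℝ) = #(S.image f) := by
  rw [← Finset.sum_fiberwise_of_maps_to (g := f) (t := S.image f)
    (fun x hx => mem_image_of_mem f hx)]
  rw [Finset.sum_congr rfl (g := fun _ => (1 : ℝ))]
  · simp
  · intro k hk
    obtain ⟨x, hx, rfl⟩ := mem_image.1 hk
    rw [Finset.sum_congr rfl (g := fun _ => (1 : ℝ) / (#{z ∈ S | f z = f x} : ℝ))]
    · have : 0 < #{z ∈ S | f z = f x} := card_pos.2 ⟨x, by simp [hx]⟩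
      rw [sum_const, nsmul_eq_mul]
      field_simp
    · intro z hz
      rw [(mem_filter.1 hz).2]

/-- The weight of a pair of distinct points of `S`: the inverse size of their common `f`-fibre,
and zero if they lie in different fibres. -/
noncomputable def fiberWeight {ι κ : Type*} [DecidableEq ι] [DecidableEq κ]
    (S : Finset ι) (f : ι → κ) (e : ι × ι) : ℝ :=
  if (e.1 ∈ S ∧ e.2 ∈ S) ∧ e.1 ≠ e.2 ∧ f e.2 = f e.1 then
    1 / (#{z ∈ S | f z = f e.1} : ℝ) else 0

lemma fiberWeight_nonneg {ι κ : Type*} [DecidableEq ι] [DecidableEq κ]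
    (S : Finset ι) (f : ι → κ) (e : ι × ι) : 0 ≤ fiberWeight S f e := by
  unfold fiberWeight
  split_ifs <;> positivity

lemma card_sub_card_image_le_sum_fiberWeight {ι κ : Type*} [DecidableEq ι] [DecidableEq κ]
    {S X : Finset ι} (hS : S ⊆ X) (f : ι → κ) :
    (#S : ℝ) - #(S.image f) ≤ ∑ e ∈ X ×ˢ X, fiberWeight S f e := by
  have hsub : S ×ˢ S ⊆ X ×ˢ X := product_subset_product hS hS
  refine le_trans ?_ (sum_le_sum_of_subset_of_nonneg hsub
    fun e _ _ => fiberWeight_nonneg S f e)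
  rw [sum_product, ← sum_inv_card_fiber, card_eq_sum_ones, Nat.cast_sum, ← sum_sub_distrib]
  refine sum_le_sum fun x hx => ?_
  have hx' : x ∈ {z ∈ S | f z = f x} := by simp [hx]
  have hpos : 0 < #{z ∈ S | f z = f x} := card_pos.2 ⟨x, hx'⟩
  have : ∑ z ∈ S, fiberWeight S f (x, z) =
      ∑ z ∈ {z ∈ S | f z = f x}.erase x, (1 : ℝ) / (#{z ∈ S | f z = f x} : ℝ) := by
    have h2 : {z ∈ S | f z = f x}.erase x = {z ∈ S | x ≠ z ∧ f z = f x} := by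
      ext z; simp only [mem_erase, mem_filter]; tauto
    rw [h2, sum_filter]
    refine sum_congr rfl fun z hz => ?_
    simp [fiberWeight, hx, hz]
  rw [this, sum_const, card_erase_of_mem hx', nsmul_eq_mul, Nat.cast_pred hpos]
  field_simp
  simp

lemma sum_fiberWeight_mul_le {ι κ κ' : Type*} [DecidableEq ι] [DecidableEq κ] [DecidableEq κ']
    (X S T : Finset ι) (f : ι → κ) (g : ι → κ') :
    ∑ e ∈ X ×ˢ X, fiberWeight S f e * fiberWeight T g e ≤
      #((S ∩ T).image fun x => (f x, g x)) := by
  rw [← sum_inv_card_fiber]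
  set P : ι → Finset ι := fun x => {z ∈ S ∩ T | (f z, g z) = (f x, g x)} with hP
  have key : ∀ e : ι × ι, fiberWeight S f e * fiberWeight T g e ≤
      if e.1 ∈ S ∩ T ∧ e.2 ∈ P e.1 then 1 / ((#(P e.1) : ℝ) * #(P e.1)) else 0 := by
    rintro ⟨x, z⟩
    unfold fiberWeight
    by_cases h : ((x ∈ S ∧ z ∈ S) ∧ x ≠ z ∧ f z = f x) ∧ ((x ∈ T ∧ z ∈ T) ∧ x ≠ z ∧ g z = g x)
    · obtain ⟨h1, h2⟩ := h
      have hx : x ∈ S ∩ T := by simp [h1.1.1, h2.1.1]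
      have hz : z ∈ P x := by simp [hP, h1.1.2, h2.1.2, h1.2.2, h2.2.2]
      have hp : 0 < #(P x) := card_pos.2 ⟨z, hz⟩
      rw [if_pos h1, if_pos h2, if_pos ⟨hx, hz⟩, div_mul_div_comm, one_mul]
      have e1 : #(P x) ≤ #{z ∈ S | f z = f x} := card_le_card fun w hw => by
        simp only [hP, mem_filter, mem_inter, Prod.mk.injEq] at hw ⊢; tauto
      have e2 : #(P x) ≤ #{z ∈ T | g z = g x} := card_le_card fun w hw => by
        simp only [hP, mem_filter, mem_inter, Prod.mk.injEq] at hw ⊢; tauto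
      gcongr
    · have : (if (x ∈ S ∧ z ∈ S) ∧ x ≠ z ∧ f z = f x then
          1 / (#{z ∈ S | f z = f x} : ℝ) else 0) *
          (if (x ∈ T ∧ z ∈ T) ∧ x ≠ z ∧ g z = g x then
          1 / (#{z ∈ T | g z = g x} : ℝ) else 0) = 0 := by
        rw [not_and_or] at h
        rcases h with h | h
        · rw [if_neg h, zero_mul]
        · rw [if_neg h, mul_zero]
      simp only [this]
      split_ifs <;> positivity
  refine (sum_le_sum fun e _ => key e).trans ?_
  rw [sum_product]
  calc _ ≤ ∑ x ∈ X, if x ∈ S ∩ T then 1 / (#(P x) : ℝ) else 0 := by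
        refine sum_le_sum fun x _ => ?_
        by_cases hx : x ∈ S ∩ T
        · have hp : 0 < #(P x) := card_pos.2 ⟨x, by simpa [hP] using hx⟩
          simp only [hx, true_and, if_true]
          rw [← sum_filter, sum_const, nsmul_eq_mul]
          have : #{z ∈ X | z ∈ P x} ≤ #(P x) := card_le_card fun w hw => (mem_filter.1 hw).2
          calc _ ≤ (#(P x) : ℝ) * (1 / ((#(P x) : ℝ) * #(P x))) := by gcongr
            _ = _ := by field_simp
        · simp [hx]
    _ ≤ _ := by
        rw [← sum_filter]
        refine sum_le_sum_of_subset_of_nonneg (fun x hx => (mem_filter.1 hx).2) ?_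
        intros; positivity

lemma card_linear_solutions_le_gcd {i j : ℕ} (hi : 0 < i) (N : ℤ) (s : Finset (ℕ × ℕ))
    (hs : ∀ p ∈ s, p.1 < i ∧ (j : ℤ) * p.1 - i * p.2 = N) : #s ≤ i.gcd j := by
  obtain ⟨g, hg⟩ : ∃ g, g = i.gcd j := ⟨_, rfl⟩
  have hg0 : 0 < g := hg ▸ Nat.gcd_pos_of_pos_left j hi
  obtain ⟨i', hi'⟩ : g ∣ i := hg ▸ Nat.gcd_dvd_left i j
  have hi'0 : 0 < i' := Nat.pos_of_ne_zero (by rintro rfl; simp at hi'; omega)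
  rw [← hg, ← card_range g]
  refine card_le_card_of_injOn (fun p => p.1 / i') (fun p hp => ?_) ?_
  · have := (hs p hp).1
    simp only [coe_range, Set.mem_Iio]
    rw [Nat.div_lt_iff_lt_mul hi'0]
    omega
  · intro p hp p' hp' h
    have h1 := (hs p hp).2
    have h2 := (hs p' hp').2
    have hdvd : i' ∣ Int.natAbs ((p.1 : ℤ) - p'.1) := by
      have hd : i ∣ j * Int.natAbs ((p.1 : ℤ) - p'.1) := by
        rw [← Int.natCast_dvd_natCast]
        push_cast
        rw [← abs_of_nonneg (Int.natCast_nonneg j), ← abs_mul, dvd_abs]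
        exact ⟨(p.2 : ℤ) - p'.2, by linear_combination h1 - h2⟩
      have hc := Nat.dvd_gcd hd (Dvd.intro _ rfl : i ∣ i * Int.natAbs ((p.1 : ℤ) - p'.1))
      rw [Nat.gcd_mul_right, Nat.gcd_comm, ← hg, hi'] at hc
      exact Nat.dvd_of_mul_dvd_mul_left hg0 hc
    have hmod : p.1 ≡ p'.1 [MOD i'] := by
      rw [Nat.modEq_iff_dvd]
      rw [← Int.natCast_dvd, ← dvd_neg] at hdvd
      simpa using hdvd
    have e1 : p.1 = p'.1 := by
      rw [← Nat.div_add_mod p.1 i', ← Nat.div_add_mod p'.1 i', hmod]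
      simp only at h
      rw [h]
    have e2 : p.2 = p'.2 := by
      rw [e1] at h1
      have : (i : ℤ) * p.2 = i * p'.2 := by linarith
      have := mul_left_cancel₀ (by exact_mod_cast hi.ne') this
      exact_mod_cast this
    exact Prod.ext e1 e2

lemma sum_gcd_le (N : ℕ) :
    ∑ i ∈ Icc 1 N, ∑ j ∈ Icc 1 N, (i.gcd j : ℝ) ≤ (N : ℝ) ^ 2 * (1 + Real.log N) := by
  have h1 : ∀ i ∈ Icc 1 N, ∀ j ∈ Icc 1 N, (i.gcd j : ℝ) ≤
      ∑ g ∈ Icc 1 N, (g : ℝ) * ((if g ∣ i then 1 else 0) * (if g ∣ j then 1 else 0)) := by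
    intro i hi j hj
    rw [mem_Icc] at hi hj
    have hm : i.gcd j ∈ Icc 1 N := mem_Icc.2 ⟨Nat.gcd_pos_of_pos_left _ hi.1,
      (Nat.gcd_le_left _ hi.1).trans hi.2⟩
    refine le_trans ?_ (single_le_sum (f := fun g : ℕ =>
      (g : ℝ) * ((if g ∣ i then 1 else 0) * (if g ∣ j then 1 else 0)))
      (fun g _ => ?_) hm)
    · simp [Nat.gcd_dvd_left, Nat.gcd_dvd_right]
    · split_ifs <;> simp
  have h2 : ∀ g : ℕ, ∑ i ∈ Icc 1 N, (if g ∣ i then (1 : ℝ) else 0) = ((N / g : ℕ) : ℝ) := by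
    intro g
    rw [sum_boole, ← Nat.Ioc_filter_dvd_card_eq_div]
    rfl
  calc _ ≤ ∑ i ∈ Icc 1 N, ∑ j ∈ Icc 1 N, ∑ g ∈ Icc 1 N,
        (g : ℝ) * ((if g ∣ i then 1 else 0) * (if g ∣ j then 1 else 0)) :=
        sum_le_sum fun i hi => sum_le_sum fun j hj => h1 i hi j hj
    _ = ∑ g ∈ Icc 1 N, (g : ℝ) * (((N / g : ℕ) : ℝ) * ((N / g : ℕ) : ℝ)) := by
        simp_rw [← h2, sum_mul_sum, mul_sum]
        rw [sum_comm' (t' := Icc 1 N) (s' := fun _ => Icc 1 N) (by tauto)]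
        rw [sum_congr rfl fun _ _ => sum_comm]
        rw [sum_comm]
        refine sum_congr rfl fun g _ => ?_
        rw [sum_comm]
    _ ≤ ∑ g ∈ Icc 1 N, (N : ℝ) ^ 2 * (g : ℝ)⁻¹ := by
        refine sum_le_sum fun g hg => ?_
        have hg0 : (0 : ℝ) < g := by exact_mod_cast (mem_Icc.1 hg).1
        have : ((N / g : ℕ) : ℝ) ≤ N / g := Nat.cast_div_le
        calc _ ≤ (g : ℝ) * ((N / g : ℝ) * (N / g : ℝ)) := by gcongr
          _ = _ := by field_simp
    _ ≤ _ := by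
        rw [← mul_sum]
        gcongr
        have := harmonic_le_one_add_log N
        rw [harmonic_eq_sum_Icc] at this
        push_cast at this
        exact this

/-- A unit multiple of a nonzero residue is rarely small. -/
lemma card_units_close_mul_le {r : ℕ} {T : ℕ} (hT : 0 < T) {x x' : ZMod (2 ^ r)} (hx : x ≠ x') :
    #{b : (ZMod (2 ^ r))ˣ | T * |((b * x : ZMod (2 ^ r)).val : ℤ) - (b * x' : ZMod (2 ^ r)).val|
      < 2 ^ r} * T ≤ 2 * 2 ^ r := by
  set d := x - x' with hd
  have hd0 : d ≠ 0 := sub_ne_zero.2 hx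
  have hv0 : d.val ≠ 0 := by rwa [Ne, ZMod.val_eq_zero]
  obtain ⟨s, e, he, hse⟩ := Nat.exists_eq_two_pow_mul_odd hv0
  have hsr : s < r := by
    have h1 : 2 ^ s ≤ d.val := Nat.le_of_dvd (Nat.pos_of_ne_zero hv0) ⟨e, hse⟩
    exact (Nat.pow_lt_pow_iff_right (by norm_num)).1 (h1.trans_lt (ZMod.val_lt d))
  set k : (ZMod (2 ^ r))ˣ → ℤ := fun b =>
    ((b * x : ZMod (2 ^ r)).val : ℤ) - (b * x' : ZMod (2 ^ r)).val with hk
  have hkd : ∀ b, ((k b : ℤ) : ZMod (2 ^ r)) = b * d := by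
    intro b; simp [hk, hd, mul_sub]
  have hk0 : ∀ b, k b ≠ 0 := by
    intro b h
    have := hkd b
    rw [h, Int.cast_zero, eq_comm, Units.mul_right_eq_zero] at this
    exact hd0 this
  have hks : ∀ b, (2 ^ s : ℤ) ∣ k b := by
    intro b
    have h1 : ((k b - (b : ZMod (2 ^ r)).val * d.val : ℤ) : ZMod (2 ^ r)) = 0 := by
      push_cast
      rw [hkd]; simp
    rw [ZMod.intCast_zmod_eq_zero_iff_dvd] at h1
    have h2 : (2 ^ s : ℤ) ∣ ((2 ^ r : ℕ) : ℤ) := by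
      push_cast; exact pow_dvd_pow _ hsr.le
    have h3 : (2 ^ s : ℤ) ∣ (b : ZMod (2 ^ r)).val * d.val := by
      rw [hse]; push_cast
      exact Dvd.intro (((b : ZMod (2 ^ r)).val : ℤ) * e) (by ring)
    simpa using dvd_add (h2.trans h1) h3
  set B : ℕ := 2 ^ r / (T * 2 ^ s) with hB
  have hcard : #{b : (ZMod (2 ^ r))ˣ | T * |k b| < 2 ^ r} ≤
      #(((Icc (-B : ℤ) B).erase 0) ×ˢ range (2 ^ s)) := by
    refine card_le_card_of_injOn
      (fun b => (k b / 2 ^ s, (b : ZMod (2 ^ r)).val / 2 ^ (r - s))) (fun b hb => ?_) ?_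
    · simp only [coe_filter, mem_univ, true_and, Set.mem_ofPred_eq] at hb
      obtain ⟨c, hc⟩ := hks b
      have hc0 : c ≠ 0 := by rintro rfl; exact hk0 b (by simpa using hc)
      have hcdiv : k b / 2 ^ s = c := by rw [hc]; simp
      have hcB : c.natAbs ≤ B := by
        rw [hB, Nat.le_div_iff_mul_le (by positivity)]
        zify
        have : (T : ℤ) * |k b| = |c| * (T * 2 ^ s) := by
          rw [hc, abs_mul, abs_of_pos (by positivity : (0 : ℤ) < 2 ^ s)]; ring
        linarith
      simp only [hcdiv, coe_product, Set.mem_prod, mem_coe, mem_erase, mem_Icc, mem_range]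
      refine ⟨⟨hc0, by omega, by omega⟩, ?_⟩
      rw [Nat.div_lt_iff_lt_mul (by positivity), ← pow_add]
      have := ZMod.val_lt (b : ZMod (2 ^ r))
      rwa [Nat.add_sub_cancel' hsr.le]
    · intro b _ b' _ h
      simp only [Prod.mk.injEq] at h
      have hkk : k b = k b' := by
        rw [← Int.ediv_mul_cancel (hks b), ← Int.ediv_mul_cancel (hks b'), h.1]
      have h1 : ((((b : ZMod (2 ^ r)).val - (b' : ZMod (2 ^ r)).val : ℤ) * d.val : ℤ) :
          ZMod (2 ^ r)) = 0 := by
        push_cast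
        simp only [ZMod.natCast_val, ZMod.cast_id', id_eq]
        rw [sub_mul, ← hkd, ← hkd, hkk, sub_self]
      rw [ZMod.intCast_zmod_eq_zero_iff_dvd, hse] at h1
      have h2 : (2 ^ (r - s) : ℤ) ∣ (b : ZMod (2 ^ r)).val - (b' : ZMod (2 ^ r)).val := by
        have h3 : (2 ^ s * 2 ^ (r - s) : ℤ) ∣
            2 ^ s * (((b : ZMod (2 ^ r)).val - (b' : ZMod (2 ^ r)).val) * e) := by
          rw [← pow_add, Nat.add_sub_cancel' hsr.le]
          convert h1 using 1 <;> push_cast <;> ring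
        have h4 := Int.dvd_of_mul_dvd_mul_left (by positivity) h3
        refine IsCoprime.dvd_of_dvd_mul_right (IsCoprime.pow_left ?_) h4
        rw [show (2 : ℤ) = ((2 : ℕ) : ℤ) from rfl, Nat.isCoprime_iff_coprime]
        exact he.coprime_two_left
      have hmod : (b : ZMod (2 ^ r)).val ≡ (b' : ZMod (2 ^ r)).val [MOD 2 ^ (r - s)] := by
        rw [Nat.modEq_iff_dvd]
        rw [← dvd_neg] at h2
        simpa using h2
      apply Units.ext
      apply ZMod.val_injective
      rw [← Nat.div_add_mod (b : ZMod (2 ^ r)).val (2 ^ (r - s)), h.2, hmod, Nat.div_add_mod]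
  have hcB : #(((Icc (-B : ℤ) B).erase 0) ×ˢ range (2 ^ s)) = 2 * B * 2 ^ s := by
    rw [card_product, card_erase_of_mem (by simp), Int.card_Icc, card_range]
    congr 1
    omega
  calc _ ≤ 2 * B * 2 ^ s * T := Nat.mul_le_mul_right _ (hcard.trans hcB.le)
    _ = 2 * (B * (T * 2 ^ s)) := by ring
    _ ≤ _ := Nat.mul_le_mul_left _ (Nat.div_mul_le_self _ _)

/-- If `i * t` reduced modulo `q` lies in the bucket `y` of `m` buckets, then `t` lies in one of
`i` cells of relative length `1 / (i * m)`. -/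
lemma cell_bounds {q m i t y : ℕ} (hq : 0 < q) (h : (i * t % q) * m / q = y) :
    q * (m * (i * t / q) + y) ≤ m * (i * t) ∧
      m * (i * t) < q * (m * (i * t / q) + y + 1) := by
  have h1 := Nat.div_add_mod (i * t) q
  have h2 := Nat.div_add_mod ((i * t % q) * m) q
  have h3 := Nat.mod_lt ((i * t % q) * m) hq
  have h5 := Nat.zero_le ((i * t % q) * m % q)
  rw [h] at h2
  have h4 : m * (i * t) = q * (m * (i * t / q)) + (i * t % q) * m := by
    nth_rewrite 1 [← h1]; ring
  constructor <;> nlinarith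

lemma le_two_mul_card_odd_Icc (K : ℕ) : K ≤ 2 * #{i ∈ Icc K (2 * K) | Odd i} := by
  have : (range ((K + 1) / 2)).card ≤ #{i ∈ Icc K (2 * K) | Odd i} := by
    refine card_le_card_of_injOn (fun t => 2 * (K / 2) + 2 * t + 1) (fun t ht => ?_) ?_
    · have ht := mem_range.1 (mem_coe.1 ht)
      simp only [coe_filter, mem_Icc, Set.mem_ofPred_eq]
      exact ⟨by omega, ⟨K / 2 + t, by ring⟩⟩
    · intro a _ b _ h
      simp only at h
      omega
  rw [card_range] at this
  omega

/-- The number of units `a` for which the multiply-shift hash `x ↦ ⌊a x m / q⌋` has a bucket with at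
least `4 * K` points of `X`. -/
lemma card_heavy_multipliers_le {m q r K n : ℕ} [NeZero q] (hq : q = 2 ^ r) (hK : 0 < K)
    (hKn : 4 * K ≤ n) (hn : n ≤ m) (X : Finset (ZMod q)) (hX : #X = n) (A : Finset (ZMod q)ˣ)
    (y : (ZMod q)ˣ → ℕ)
    (hA : ∀ a ∈ A, 4 * K ≤ #{x ∈ X | (a * x : ZMod q).val * m / q = y a}) :
    (#A : ℝ) * K ^ 3 ≤ 24 * n * q * Real.log n := by
  have hm0 : 0 < m := by omega
  have hq0 : 0 < q := NeZero.pos q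
  have hclose : ∀ x x' : ZMod q, x ≠ x' → #{b : (ZMod q)ˣ |
      ((m * K : ℕ) : ℤ) * |((b * x : ZMod q).val : ℤ) - (b * x' : ZMod q).val| < q} * (m * K)
        ≤ 2 * q := by
    subst hq
    intro x x' hx
    have := card_units_close_mul_le (T := m * K) (by positivity) hx
    push_cast at this ⊢
    exact this
  set I : Finset ℕ := {i ∈ Icc K (2 * K) | Odd i} with hI
  have hIK : ∀ i ∈ I, K ≤ i ∧ i ≤ 2 * K := fun i hi => mem_Icc.1 (mem_filter.1 hi).1
  have hu : ∀ i ∈ I, ∃ u : (ZMod q)ˣ, (u : ZMod q) = i := fun i hi =>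
    ⟨ZMod.unitOfCoprime i (hq ▸ (mem_filter.1 hi).2.coprime_two_right.pow_right r),
      ZMod.coe_unitOfCoprime _ _⟩
  choose! u hu using hu
  set S : (ZMod q)ˣ → Finset (ZMod q) :=
    fun a => {x ∈ X | (a * x : ZMod q).val * m / q = y a} with hS
  set c : (ZMod q)ˣ → ℕ → ZMod q → ℕ := fun b i x => i * (b * x : ZMod q).val / q with hc
  have hcell : ∀ b, ∀ i ∈ I, ∀ x ∈ S (u i * b),
      q * (m * c b i x + y (u i * b)) ≤ m * (i * (b * x : ZMod q).val) ∧
      m * (i * (b * x : ZMod q).val) < q * (m * c b i x + y (u i * b) + 1) := by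
    intro b i hi x hx
    refine cell_bounds hq0 ?_
    have := (mem_filter.1 hx).2
    rw [Units.val_mul, hu i hi, mul_assoc, ZMod.val_mul, ZMod.val_natCast, Nat.mod_mul_mod] at this
    exact this
  have hclt : ∀ b, ∀ i ∈ I, ∀ x, c b i x < i := by
    intro b i hi x
    rw [hc, Nat.div_lt_iff_lt_mul hq0]
    exact Nat.mul_lt_mul_of_pos_left (ZMod.val_lt _) (hK.trans_le (hIK i hi).1)
  set w : (ZMod q)ˣ → ℕ → ZMod q × ZMod q → ℝ :=
    fun b i e => if u i * b ∈ A then fiberWeight (S (u i * b)) (c b i) e else 0 with hw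
  -- the pairs that `b` sends close to each other
  set E : Finset ((ZMod q)ˣ × (ZMod q × ZMod q)) := {p ∈ univ ×ˢ X.offDiag |
    ((m * K : ℕ) : ℤ) * |((p.1 * p.2.1 : ZMod q).val : ℤ) - (p.1 * p.2.2 : ZMod q).val| < q}
    with hE
  have hsupp : ∀ b, ∀ i ∈ I, ∀ e, (b, e) ∉ E → w b i e = 0 := by
    rintro b i hi ⟨x, x'⟩ he
    by_contra hne
    apply he
    simp only [hw, fiberWeight] at hne
    split_ifs at hne with h1 h2
    · obtain ⟨⟨hx, hx'⟩, hxx, hcc⟩ := h2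
      obtain ⟨a1, a2⟩ := hcell b i hi x hx
      obtain ⟨b1, b2⟩ := hcell b i hi x' hx'
      rw [hcc] at b1 b2
      simp only [hE, mem_filter, mem_product, mem_univ, true_and, mem_offDiag]
      refine ⟨⟨(mem_filter.1 hx).1, (mem_filter.1 hx').1, hxx⟩, ?_⟩
      have hi1 := (hIK i hi).1
      have h3 : (m : ℤ) * (i * |((b * x : ZMod q).val : ℤ) - (b * x' : ZMod q).val|) < q := by
        zify at a1 a2 b1 b2
        rcases abs_cases (((b * x : ZMod q).val : ℤ) - (b * x' : ZMod q).val) with h | h <;>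
          rw [h.1] <;> linarith
      refine lt_of_le_of_lt ?_ h3
      push_cast
      rw [mul_assoc]
      gcongr
    all_goals exact absurd rfl hne
  have hlow : ∀ b, ∀ i ∈ I, (if u i * b ∈ A then (2 * K : ℝ) else 0) ≤
      ∑ e ∈ X ×ˢ X, w b i e := by
    intro b i hi
    simp only [hw]
    split_ifs with h
    · refine le_trans ?_ (card_sub_card_image_le_sum_fiberWeight (filter_subset _ X) _)
      have h1 : #((S (u i * b)).image (c b i)) ≤ i := by
        refine (card_le_card (t := range i) fun k hk => ?_).trans_eq (card_range i)
        obtain ⟨x, -, rfl⟩ := mem_image.1 hk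
        exact mem_range.2 (hclt b i hi x)
      have h2 : (#((S (u i * b)).image (c b i)) : ℝ) ≤ 2 * K := by
        exact_mod_cast h1.trans (hIK i hi).2
      have h3 : (4 * K : ℝ) ≤ #(S (u i * b)) := by exact_mod_cast hA _ h
      linarith
    · simp
  have hcross : ∀ b, ∀ i ∈ I, ∀ j ∈ I, ∑ e ∈ X ×ˢ X, w b i e * w b j e ≤
      if u i * b ∈ A then (i.gcd j : ℝ) else 0 := by
    intro b i hi j hj
    simp only [hw]
    split_ifs with h1 h2
    · refine (sum_fiberWeight_mul_le _ _ _ _ _).trans ?_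
      norm_cast
      rcases (S (u i * b) ∩ S (u j * b)).eq_empty_or_nonempty with h0 | ⟨z, hz⟩
      · simp [h0]
      have hspread : ∀ x ∈ S (u i * b) ∩ S (u j * b),
          (i * y (u j * b) : ℤ) - j * y (u i * b) - j
              < m * ((j : ℤ) * c b i x - i * c b j x) ∧
          m * ((j : ℤ) * c b i x - i * c b j x) < (i * y (u j * b) : ℤ) - j * y (u i * b) + i := by
        intro x hx
        rw [mem_inter] at hx
        obtain ⟨a1, a2⟩ := hcell b i hi x hx.1
        obtain ⟨b1, b2⟩ := hcell b j hj x hx.2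
        have hi0 : 0 < i := hK.trans_le (hIK i hi).1
        have hj0 : 0 < j := hK.trans_le (hIK j hj).1
        have c1 := (Nat.mul_le_mul_left j a1).trans_lt
          ((by ring : j * (m * (i * (b * x : ZMod q).val)) =
            i * (m * (j * (b * x : ZMod q).val))).trans_lt (Nat.mul_lt_mul_of_pos_left b2 hi0))
        have c2 := (Nat.mul_le_mul_left i b1).trans_lt
          ((by ring : i * (m * (j * (b * x : ZMod q).val)) =
            j * (m * (i * (b * x : ZMod q).val))).trans_lt (Nat.mul_lt_mul_of_pos_left a2 hj0))
        rw [mul_left_comm j q, mul_left_comm i q] at c1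
        rw [mul_left_comm i q, mul_left_comm j q] at c2
        have d1 := Nat.lt_of_mul_lt_mul_left c1
        have d2 := Nat.lt_of_mul_lt_mul_left c2
        zify at d1 d2
        constructor <;> linarith
      refine card_linear_solutions_le_gcd (hK.trans_le (hIK i hi).1)
        ((j : ℤ) * c b i z - i * c b j z) _ fun p hp => ?_
      obtain ⟨x, hx, rfl⟩ := mem_image.1 hp
      refine ⟨hclt b i hi x, ?_⟩
      obtain ⟨a1, a2⟩ := hspread x hx
      obtain ⟨b1, b2⟩ := hspread z hz
      simp only
      generalize (j : ℤ) * c b i x - i * c b j x = N at *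
      generalize (j : ℤ) * c b i z - i * c b j z = N' at *
      have hij : (i : ℤ) + j ≤ m := by
        have := (hIK i hi).2; have := (hIK j hj).2; omega
      have e1 : (m : ℤ) * (N - N') < m * 1 := by linarith
      have e2 : (m : ℤ) * (N' - N) < m * 1 := by linarith
      have f1 := lt_of_mul_lt_mul_left e1 (by positivity)
      have f2 := lt_of_mul_lt_mul_left e2 (by positivity)
      omega
    all_goals simp
  have hshift : ∀ (i : ℕ) (k : ℝ), ∑ b : (ZMod q)ˣ, (if u i * b ∈ A then k else 0) = #A * k := by
    intro i k
    refine (Equiv.sum_comp (Equiv.mulLeft (u i)) fun b => if b ∈ A then k else 0).trans ?_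
    simp
  have hEcard : (#E : ℝ) * K ≤ 2 * n * q := by
    have h1 : #E * (m * K) ≤ n * n * (2 * q) := by
      have h2 : #E = ∑ e ∈ X.offDiag, #{b : (ZMod q)ˣ |
          ((m * K : ℕ) : ℤ) * |((b * e.1 : ZMod q).val : ℤ) - (b * e.2 : ZMod q).val| < q} := by
        simp only [hE, card_filter]
        rw [sum_product, sum_comm]
      rw [h2, sum_mul]
      calc _ ≤ ∑ e ∈ X.offDiag, 2 * q := by
            exact sum_le_sum fun e he => hclose _ _ (mem_offDiag.1 he).2.2
        _ ≤ _ := by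
            rw [sum_const, smul_eq_mul]
            gcongr
            rw [offDiag_card, hX]
            omega
    have h3 : m * (#E * K) ≤ m * (2 * n * q) := by
      calc _ = #E * (m * K) := by ring
        _ ≤ n * n * (2 * q) := h1
        _ ≤ m * n * (2 * q) := by gcongr
        _ = _ := by ring
    exact_mod_cast Nat.le_of_mul_le_mul_left h3 hm0
  have hsub : E ⊆ univ ×ˢ (X ×ˢ X) := fun p hp => by
    have := mem_offDiag.1 (mem_product.1 (mem_filter.1 hp).1).2
    simp [this.1, this.2.1]
  have hsum_low : (#A : ℝ) * #I * (2 * K) ≤ ∑ p ∈ E, ∑ i ∈ I, w p.1 i p.2 := by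
    rw [sum_subset hsub fun p _ hp => sum_eq_zero fun i hi => hsupp p.1 i hi p.2 hp,
      sum_product, sum_congr rfl fun _ _ => sum_comm, sum_comm]
    calc (#A : ℝ) * #I * (2 * K) = ∑ i ∈ I, (#A : ℝ) * (2 * K) := by
          rw [sum_const, nsmul_eq_mul]; ring
      _ ≤ _ := sum_le_sum fun i hi => by
          rw [← hshift i]
          exact sum_le_sum fun b _ => hlow b i hi
  have hsq : ∑ p ∈ E, (∑ i ∈ I, w p.1 i p.2) ^ 2 ≤
      #A * ((2 * K : ℝ) ^ 2 * (1 + Real.log (2 * K))) := by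
    calc _ ≤ ∑ p ∈ univ ×ˢ (X ×ˢ X), (∑ i ∈ I, w p.1 i p.2) ^ 2 :=
          sum_le_sum_of_subset_of_nonneg hsub fun _ _ _ => sq_nonneg _
      _ = ∑ i ∈ I, ∑ j ∈ I, ∑ b, ∑ e ∈ X ×ˢ X, w b i e * w b j e := by
          simp_rw [sq, sum_mul_sum]
          rw [sum_comm]
          refine sum_congr rfl fun i _ => ?_
          rw [sum_comm]
          refine sum_congr rfl fun j _ => ?_
          rw [sum_product]
      _ ≤ ∑ i ∈ I, ∑ j ∈ I, (#A : ℝ) * i.gcd j := by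
          refine sum_le_sum fun i hi => sum_le_sum fun j hj => ?_
          rw [← hshift i]
          exact sum_le_sum fun b _ => hcross b i hi j hj
      _ ≤ ∑ i ∈ Icc 1 (2 * K), ∑ j ∈ Icc 1 (2 * K), (#A : ℝ) * i.gcd j := by
          have hII : I ⊆ Icc 1 (2 * K) := fun i hi => by
            have := hIK i hi
            exact mem_Icc.2 ⟨by omega, this.2⟩
          refine (sum_le_sum fun i _ => sum_le_sum_of_subset_of_nonneg hII
            fun _ _ _ => by positivity).trans (sum_le_sum_of_subset_of_nonneg hII
            fun _ _ _ => by positivity)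
      _ ≤ _ := by
          simp_rw [← mul_sum]
          gcongr
          have := sum_gcd_le (2 * K)
          push_cast at this
          exact this
  have hCS := sq_sum_le_card_mul_sum_sq (s := E) (f := fun p => ∑ i ∈ I, w p.1 i p.2)
  have hlog : 1 + Real.log (2 * K) ≤ 3 * Real.log n := by
    have hn4 : (4 * K : ℝ) ≤ n := by exact_mod_cast hKn
    have hK1 : (1 : ℝ) ≤ K := by exact_mod_cast hK
    have h1 : Real.log (2 * K) ≤ Real.log n := Real.log_le_log (by positivity) (by linarith)
    have h2 : Real.log 2 ≤ Real.log n := Real.log_le_log (by positivity) (by linarith)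
    have := Real.log_two_gt_d9
    linarith
  have hIcard : (K : ℝ) ≤ 2 * #I := by exact_mod_cast le_two_mul_card_odd_Icc K
  rcases (Nat.cast_nonneg (α := ℝ) #A).eq_or_lt with hA0 | hA0
  · rw [← hA0, zero_mul]
    have : 0 ≤ Real.log n := Real.log_natCast_nonneg n
    positivity
  have hK0 : (0 : ℝ) < K := by exact_mod_cast hK
  have hlogn : 0 ≤ Real.log n := Real.log_natCast_nonneg n
  have hlower : ((#A : ℝ) * K ^ 2) ^ 2 ≤ (∑ p ∈ E, ∑ i ∈ I, w p.1 i p.2) ^ 2 := by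
    refine pow_le_pow_left₀ (by positivity) (le_trans ?_ hsum_low) 2
    nlinarith [mul_le_mul_of_nonneg_left hIcard (by positivity : 0 ≤ (#A : ℝ) * K)]
  have hfin : (#A : ℝ) * K ^ 2 * ((#A : ℝ) * K ^ 3) ≤
      (#A : ℝ) * K ^ 2 * (24 * n * q * Real.log n) := by
    calc _ = ((#A : ℝ) * K ^ 2) ^ 2 * K := by ring
      _ ≤ (#E * (#A * ((2 * K : ℝ) ^ 2 * (3 * Real.log n)))) * K := by
          gcongr
          refine hlower.trans (hCS.trans ?_)
          gcongr
          refine hsq.trans ?_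
          gcongr
      _ = (#E * K : ℝ) * (#A * ((2 * K : ℝ) ^ 2 * (3 * Real.log n))) := by ring
      _ ≤ (2 * n * q) * (#A * ((2 * K : ℝ) ^ 2 * (3 * Real.log n))) := by gcongr
      _ = _ := by ring
  exact le_of_mul_le_mul_left hfin (by positivity)

lemma filter_odd_eq_map_units {r : ℕ} (hr : 0 < r) :
    (univ.filter fun a : ZMod (2 ^ r) => a.val % 2 = 1) =
      univ.map ⟨Units.val, Units.val_injective⟩ := by
  ext a
  simp only [mem_filter, mem_univ, true_and, mem_map, Function.Embedding.coeFn_mk]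
  rw [← Nat.odd_iff]
  constructor
  · intro h
    refine ⟨ZMod.unitOfCoprime a.val (h.coprime_two_right.pow_right r), ?_⟩
    simp
  · rintro ⟨v, rfl⟩
    rw [← Nat.coprime_two_right]
    exact (ZMod.val_coe_unit_coprime v).coprime_dvd_right (dvd_pow_self 2 hr.ne')


/-- **Tail bound for the longest chain of the multiply-shift hash function.**
Let `q = 2^r`, `m = 2^ℓ`, `q ≥ m ≥ n ≥ 2`, and `X ⊆ Z_q` with `|X| = n`. For `a`
uniform among the odd residues of `Z_q`, with
`M = max_{y < m} |{x ∈ X : ⌊lift_q (a·x)·m/q⌋ = y}|`, for every real `α` with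
`1 ≤ α ≤ n/4` we have `Pr[M ≥ 4α] ≤ C · n · log n / α³` for an absolute constant `C`. -/
theorem tail_bound_multiply_shift :
    ∃ C : ℝ, 0 < C ∧
      ∀ (n ℓ r : ℕ), 0 < ℓ → 0 < r → ℓ ≤ r → 2 ≤ n → n ≤ 2 ^ ℓ →
        ∀ X : Finset (ZMod (2 ^ r)), X.card = n →
          ∀ α : ℝ, 1 ≤ α → α ≤ (n : ℝ) / 4 →
            (((Finset.univ.filter (fun a : ZMod (2 ^ r) => ZMod.val a % 2 = 1)).filter
                (fun a : ZMod (2 ^ r) =>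
                  4 * α ≤ (((Finset.range (2 ^ ℓ)).sup (fun y =>
                    (X.filter fun x =>
                      ZMod.val (a * x) * 2 ^ ℓ / 2 ^ r = y).card) : ℕ) : ℝ))).card : ℝ)
              / ((Finset.univ.filter (fun a : ZMod (2 ^ r) => ZMod.val a % 2 = 1)).card : ℝ)
            ≤ C * (n : ℝ) * Real.log n / α ^ 3 := by
  refine ⟨384, by norm_num, ?_⟩
  intro n ℓ r _ hr _ hn2 hn X hX α hα1 hα
  rw [filter_odd_eq_map_units hr, filter_map, card_map, card_map]
  set K := ⌊α⌋₊ with hKdef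
  have hK : 0 < K := Nat.floor_pos.2 hα1
  have hKα : (K : ℝ) ≤ α := Nat.floor_le (by linarith)
  have hαK : α ≤ 2 * K := by
    have := Nat.lt_floor_add_one α
    have hK1 : (1 : ℝ) ≤ K := by exact_mod_cast hK
    linarith
  have hKn : 4 * K ≤ n := by
    have : (4 * K : ℝ) ≤ n := by linarith
    exact_mod_cast this
  set A : Finset (ZMod (2 ^ r))ˣ := _ with hAdef
  change ((#A : ℕ) : ℝ) / _ ≤ _
  have hex : ∀ a ∈ A, ∃ y, 4 * K ≤
      #{x ∈ X | (a * x : ZMod (2 ^ r)).val * 2 ^ ℓ / 2 ^ r = y} := by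
    intro a ha
    have h1 := (mem_filter.1 ha).2
    simp only [Function.comp_apply, Function.Embedding.coeFn_mk] at h1
    obtain ⟨y, -, hy⟩ := exists_mem_eq_sup (range (2 ^ ℓ)) (by simp) (fun y =>
      #{x ∈ X | (a * x : ZMod (2 ^ r)).val * 2 ^ ℓ / 2 ^ r = y})
    rw [hy] at h1
    refine ⟨y, ?_⟩
    have : (4 * K : ℝ) ≤ _ := le_trans (by linarith) h1
    exact_mod_cast this
  choose! y hy using hex
  have hmain := card_heavy_multipliers_le rfl hK hKn hn X hX A y hy
  push_cast at hmain
  have hunits : (#(univ : Finset (ZMod (2 ^ r))ˣ) : ℝ) * 2 = 2 ^ r := by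
    rw [card_univ, ZMod.card_units_eq_totient, Nat.totient_prime_pow Nat.prime_two hr]
    obtain ⟨s, rfl⟩ := Nat.exists_eq_succ_of_ne_zero hr.ne'
    simp [pow_succ]
  have hlog : 0 ≤ Real.log n := Real.log_natCast_nonneg n
  have hU : (0 : ℝ) < #(univ : Finset (ZMod (2 ^ r))ˣ) := by
    have : (0 : ℝ) < 2 ^ r := by positivity
    linarith
  rw [div_le_div_iff₀ hU (by positivity)]
  calc (#A : ℝ) * α ^ 3 ≤ (#A : ℝ) * (2 * K : ℝ) ^ 3 := by gcongr
    _ = 8 * ((#A : ℝ) * (K : ℝ) ^ 3) := by ring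
    _ ≤ 8 * (24 * (n : ℝ) * 2 ^ r * Real.log n) := by gcongr
    _ = _ := by rw [← hunits]; ring
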